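/- Let P ≥ 2, Q ≥ 2 be real numbers, let a, b, c, d, e, f be integers in [−Q, Q], and set Δ = 4ac − b². Let N(P,Q) denote the number of integer solutions (x,y) of a·x² + b·x·y + c·y² + d·x + e·y + f = 0 with |x| ≤ P and |y| ≤ P. Suppose either (a ≠ 0, Δ = 0, and l = 2ae − bd ≠ 0) or (c ≠ 0, Δ = 0, and l = 2cd − be ≠ 0), and let k² be the largest square dividing |l|. Then for every ε > 0 there is a constant C depending only on ε with N(P,Q) ≤ C·Q^ε·(1 + k·√(P/|l|)). -/

import Mathlib

/-- The divisor bound: `n` has `O_δ(n ^ δ)` divisors. -/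
theorem exists_card_divisors_le_rpow (δ : ℝ) (hδ : 0 < δ) :
    ∃ C : ℝ, 0 < C ∧ ∀ n : ℕ, n ≠ 0 → (n.divisors.card : ℝ) ≤ C * (n : ℝ) ^ δ := by
  obtain ⟨B, hB⟩ := exists_nat_ge ((2 : ℝ) ^ (1 / δ))
  have hlog : 0 < δ * Real.log 2 := mul_pos hδ (Real.log_pos one_lt_two)
  set A : ℝ := max 1 (1 / (δ * Real.log 2))
  have hA1 : 1 ≤ A := le_max_left _ _
  have hA2 : 1 ≤ A * (δ * Real.log 2) := by
    rw [← div_le_iff₀ hlog]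
    exact le_max_right _ _
  have small (p e : ℕ) (hp : 2 ≤ p) : (e : ℝ) + 1 ≤ A * ((p : ℝ) ^ δ) ^ e := by
    have h1 : δ * Real.log 2 * e + 1 ≤ ((2 : ℝ) ^ δ) ^ e := by
      rw [Real.rpow_def_of_pos two_pos, ← Real.exp_nat_mul]
      convert Real.add_one_le_exp (e * (Real.log 2 * δ)) using 1
      ring
    have h2 : ((2 : ℝ) ^ δ) ^ e ≤ ((p : ℝ) ^ δ) ^ e := by
      have : (2 : ℝ) ≤ p := by exact_mod_cast hp
      gcongr
    have he : (0 : ℝ) ≤ e := by positivity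
    calc (e : ℝ) + 1 ≤ A * (δ * Real.log 2) * e + A := by nlinarith
      _ = A * (δ * Real.log 2 * e + 1) := by ring
      _ ≤ A * ((p : ℝ) ^ δ) ^ e := by gcongr; exact h1.trans h2
  have large (p e : ℕ) (hp : B ≤ p) : (e : ℝ) + 1 ≤ ((p : ℝ) ^ δ) ^ e := by
    have h2 : (2 : ℝ) ≤ (p : ℝ) ^ δ := by
      have h : (2 : ℝ) ^ (1 / δ) ≤ p := hB.trans (by exact_mod_cast hp)
      calc (2 : ℝ) = ((2 : ℝ) ^ (1 / δ)) ^ δ := by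
            rw [← Real.rpow_mul two_pos.le, one_div_mul_cancel hδ.ne', Real.rpow_one]
        _ ≤ (p : ℝ) ^ δ := by gcongr
    calc (e : ℝ) + 1 ≤ (2 : ℝ) ^ e := by exact_mod_cast Nat.lt_two_pow_self
      _ ≤ _ := by gcongr
  refine ⟨A ^ B, by positivity, fun n hn => ?_⟩
  have hprod : (n : ℝ) ^ δ = ∏ p ∈ n.primeFactors, ((p : ℝ) ^ δ) ^ n.factorization p := by
    conv_lhs => rw [← Nat.prod_factorization_pow_eq_self hn]
    rw [Finsupp.prod, Nat.cast_prod, Nat.support_factorization,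
      ← Real.finsetProd_rpow _ _ (fun _ _ => by positivity)]
    refine Finset.prod_congr rfl fun p _ => ?_
    rw [Nat.cast_pow, ← Real.rpow_natCast, ← Real.rpow_mul (by positivity),
      ← Real.rpow_natCast, ← Real.rpow_mul (by positivity), mul_comm]
  rw [Nat.card_divisors hn, hprod, Nat.cast_prod]
  calc ∏ p ∈ n.primeFactors, ((n.factorization p + 1 : ℕ) : ℝ)
      ≤ ∏ p ∈ n.primeFactors, (if p < B then A else 1) * ((p : ℝ) ^ δ) ^ n.factorization p := by
        refine Finset.prod_le_prod (fun _ _ => by positivity) fun p hp => ?_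
        push_cast
        split_ifs with h
        · exact small p _ (Nat.prime_of_mem_primeFactors hp).two_le
        · rw [one_mul]
          exact large p _ (not_lt.mp h)
    _ = A ^ (n.primeFactors.filter (· < B)).card
          * ∏ p ∈ n.primeFactors, ((p : ℝ) ^ δ) ^ n.factorization p := by
        rw [Finset.prod_mul_distrib, Finset.prod_ite, Finset.prod_const, Finset.prod_const_one,
          mul_one]
    _ ≤ _ := by
        gcongr
        calc _ ≤ (Finset.range B).card :=
                Finset.card_le_card fun p hp => by simpa using (Finset.mem_filter.mp hp).2
            _ = B := Finset.card_range B

/-- A set of pairwise congruent integers of diameter at most `L` has at most `1 + L / M`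
elements, where `M` is the modulus. -/
theorem card_le_of_pairwise_modEq (T : Finset ℤ) (M : ℕ) (hM : 0 < M) (L : ℝ) (hL : 0 ≤ L)
    (hdvd : ∀ u ∈ T, ∀ v ∈ T, (M : ℤ) ∣ u - v) (hdiam : ∀ u ∈ T, ∀ v ∈ T, ((u - v : ℤ) : ℝ) ≤ L) :
    (T.card : ℝ) ≤ 1 + L / M := by
  have hM' : (0 : ℝ) < M := by exact_mod_cast hM
  rcases T.eq_empty_or_nonempty with rfl | hT
  · simp only [Finset.card_empty, Nat.cast_zero]
    positivity
  set t := T.min' hT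
  have ht : t ∈ T := T.min'_mem hT
  have hsub : T ⊆ (Finset.range (⌊L / M⌋₊ + 1)).image (fun j : ℕ => t + M * j) := by
    intro u hu
    obtain ⟨j, hj⟩ := hdvd u hu t ht
    have htu : t ≤ u := T.min'_le u hu
    have hj0 : 0 ≤ j := by
      by_contra! h
      have : (M : ℤ) * j < 0 := mul_neg_of_pos_of_neg (by exact_mod_cast hM) h
      linarith
    lift j to ℕ using hj0
    refine Finset.mem_image.mpr ⟨j, ?_, by linarith⟩
    rw [Finset.mem_range, Nat.lt_succ_iff]
    refine Nat.le_floor ?_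
    rw [le_div_iff₀ hM', mul_comm]
    have := hdiam u hu t ht
    rw [hj] at this
    exact_mod_cast this
  have h1 : T.card ≤ ⌊L / M⌋₊ + 1 :=
    (Finset.card_le_card hsub).trans (Finset.card_image_le.trans (Finset.card_range _).le)
  have h2 : (⌊L / M⌋₊ : ℝ) ≤ L / M := Nat.floor_le (by positivity)
  have h3 : (T.card : ℝ) ≤ ⌊L / M⌋₊ + 1 := by exact_mod_cast h1
  linarith

/-- If `m ∣ u ^ 2 - w ^ 2`, then `u ≡ -w` modulo `m / gcd (u - w, m)`. -/
theorem div_gcd_dvd_add_of_dvd_sq_sub_sq {m : ℕ} (hm : 0 < m) {u w : ℤ}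
    (h : (m : ℤ) ∣ u ^ 2 - w ^ 2) : ((m / Int.gcd (u - w) m : ℕ) : ℤ) ∣ u + w := by
  have hg : 0 < Int.gcd (u - w) m := Int.gcd_pos_of_ne_zero_right _ (by exact_mod_cast hm.ne')
  have hco := Int.gcd_ediv_gcd_ediv_gcd hg
  rw [Int.natCast_div]
  refine Int.dvd_of_dvd_mul_right_of_gcd_one (b := (u - w) / (Int.gcd (u - w) m : ℤ)) ?_ ?_
  · obtain ⟨a, ha⟩ := Int.gcd_dvd_left (u - w) m
    obtain ⟨b, hb⟩ := Int.gcd_dvd_right (u - w) m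
    obtain ⟨s, hs⟩ := h
    have hg' : (Int.gcd (u - w) m : ℤ) ≠ 0 := by exact_mod_cast hg.ne'
    rw [Int.ediv_eq_of_eq_mul_right hg' ha, Int.ediv_eq_of_eq_mul_right hg' hb]
    refine ⟨s, mul_left_cancel₀ hg' ?_⟩
    linear_combination hs - (u + w) * ha + s * hb
  · rw [Int.gcd_comm]
    exact hco

/-- A set of nonnegative integers whose squares are congruent modulo `m` and lie within `R` of
each other is small, in terms of a bound `k` for the square divisors of `m`. -/
theorem card_le_of_sq_modEq (T : Finset ℤ) (m k : ℕ) (hm : 0 < m)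
    (hk : ∀ k' : ℕ, k' ^ 2 ∣ m → k' ≤ k) (R : ℝ)
    (hnonneg : ∀ u ∈ T, 0 ≤ u) (hdvd : ∀ u ∈ T, ∀ v ∈ T, (m : ℤ) ∣ u ^ 2 - v ^ 2)
    (hdiam : ∀ u ∈ T, ∀ v ∈ T, ((u ^ 2 - v ^ 2 : ℤ) : ℝ) ≤ R) :
    (T.card : ℝ) ≤ m.divisors.card * (1 + k * Real.sqrt R / m) := by
  have hm' : (0 : ℝ) < m := by exact_mod_cast hm
  rcases T.eq_empty_or_nonempty with rfl | ⟨w, hw⟩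
  · simp only [Finset.card_empty, Nat.cast_zero]
    positivity
  have hmaps : ∀ u ∈ T, Int.gcd (u - w) m ∈ m.divisors := fun u _ =>
    Nat.mem_divisors.mpr ⟨by exact_mod_cast Int.gcd_dvd_right (u - w) m, hm.ne'⟩
  have hfiber (g : ℕ) (hg : g ∈ m.divisors) :
      ((T.filter fun u => Int.gcd (u - w) m = g).card : ℝ) ≤ 1 + k * Real.sqrt R / m := by
    have hgm : g ∣ m := Nat.dvd_of_mem_divisors hg
    have hg0 : 0 < g := Nat.pos_of_dvd_of_pos hgm hm
    have hmul : g * (m / g) = m := Nat.mul_div_cancel' hgm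
    have hlcm : Nat.gcd g (m / g) * Nat.lcm g (m / g) = m := by rw [Nat.gcd_mul_lcm, hmul]
    have hgcd : Nat.gcd g (m / g) ≤ k := by
      refine hk _ ?_
      conv_rhs => rw [← hmul]
      rw [pow_two]
      exact mul_dvd_mul (Nat.gcd_dvd_left _ _) (Nat.gcd_dvd_right _ _)
    have hM : 0 < Nat.lcm g (m / g) := Nat.lcm_pos hg0 (Nat.div_pos (Nat.le_of_dvd hm hgm) hg0)
    refine (card_le_of_pairwise_modEq _ (Nat.lcm g (m / g)) hM (Real.sqrt R)
      (Real.sqrt_nonneg R) ?_ ?_).trans ?_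
    · intro u hu v hv
      obtain ⟨hu, hug⟩ := Finset.mem_filter.mp hu
      obtain ⟨hv, hvg⟩ := Finset.mem_filter.mp hv
      have h1 : (g : ℤ) ∣ u - v := by
        have hu1 := Int.gcd_dvd_left (u - w) m
        have hv1 := Int.gcd_dvd_left (v - w) m
        rw [hug] at hu1
        rw [hvg] at hv1
        simpa using dvd_sub hu1 hv1
      have h2 : ((m / g : ℕ) : ℤ) ∣ u - v := by
        have hu1 := div_gcd_dvd_add_of_dvd_sq_sub_sq hm (hdvd u hu w hw)
        have hv1 := div_gcd_dvd_add_of_dvd_sq_sub_sq hm (hdvd v hv w hw)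
        rw [hug] at hu1
        rw [hvg] at hv1
        simpa using dvd_sub hu1 hv1
      rw [Int.natCast_dvd] at *
      exact Nat.lcm_dvd h1 h2
    · intro u hu v hv
      have hu := (Finset.mem_filter.mp hu).1
      have hv := (Finset.mem_filter.mp hv).1
      refine Real.le_sqrt_of_sq_le ?_
      rcases le_total u v with h | h
      · have h' := hdiam v hv u hu
        have hu0 := hnonneg u hu
        have : (u - v) ^ 2 ≤ v ^ 2 - u ^ 2 := by nlinarith
        exact le_trans (by exact_mod_cast this) h'
      · have h' := hdiam u hu v hv
        have hv0 := hnonneg v hv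
        have : (u - v) ^ 2 ≤ u ^ 2 - v ^ 2 := by nlinarith
        exact le_trans (by exact_mod_cast this) h'
    · have hM' : (0 : ℝ) < (Nat.lcm g (m / g) : ℕ) := by exact_mod_cast hM
      have hle : (m : ℝ) ≤ k * (Nat.lcm g (m / g) : ℕ) := by
        have : m ≤ k * Nat.lcm g (m / g) := hlcm.symm.le.trans (Nat.mul_le_mul_right _ hgcd)
        exact_mod_cast this
      refine add_le_add_right ?_ 1
      rw [div_le_div_iff₀ hM' hm']
      nlinarith [mul_le_mul_of_nonneg_left hle (Real.sqrt_nonneg R)]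
  calc (T.card : ℝ)
      = ∑ g ∈ m.divisors, ((T.filter fun u => Int.gcd (u - w) m = g).card : ℝ) := by
        exact_mod_cast Finset.card_eq_sum_card_fiberwise hmaps
    _ ≤ ∑ _g ∈ m.divisors, (1 + k * Real.sqrt R / m) := Finset.sum_le_sum hfiber
    _ = _ := by rw [Finset.sum_const, nsmul_eq_mul]

/-- The integer zeros with `|x|, |y| ≤ P` of a quadratic polynomial with vanishing discriminant
and `a ≠ 0`, `l = 2ae - bd ≠ 0`: bound in terms of the number of divisors of `l`. -/
theorem card_quadratic_zeros_le (P : ℝ) (a b c d e f l : ℤ) (k : ℕ)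
    (hΔ : 4 * a * c - b ^ 2 = 0) (ha : a ≠ 0) (hl : l = 2 * a * e - b * d) (hl0 : l ≠ 0)
    (hk : ∀ k' : ℕ, k' ^ 2 ∣ l.natAbs → k' ≤ k) :
    (Nat.card {xy : ℤ × ℤ // (|xy.1| : ℝ) ≤ P ∧ (|xy.2| : ℝ) ≤ P ∧
        a * xy.1 ^ 2 + b * xy.1 * xy.2 + c * xy.2 ^ 2 + d * xy.1 + e * xy.2 + f = 0} : ℝ)
      ≤ 4 * l.natAbs.divisors.card * (1 + (k : ℝ) * Real.sqrt (P / (l.natAbs : ℝ))) := by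
  set S : Set (ℤ × ℤ) := {xy | (|xy.1| : ℝ) ≤ P ∧ (|xy.2| : ℝ) ≤ P ∧
    a * xy.1 ^ 2 + b * xy.1 * xy.2 + c * xy.2 ^ 2 + d * xy.1 + e * xy.2 + f = 0}
  have hm : 0 < l.natAbs := Int.natAbs_pos.mpr hl0
  set m := l.natAbs
  have hm' : (0 : ℝ) < m := by exact_mod_cast hm
  have hS : S.Finite := by
    have hmem (z : ℤ) (hz : (|z| : ℝ) ≤ P) : z ∈ Set.Icc (-⌊P⌋) ⌊P⌋ := by
      rw [Set.mem_Icc, ← abs_le, Int.le_floor]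
      exact_mod_cast hz
    exact ((Set.finite_Icc _ _).prod (Set.finite_Icc _ _)).subset
      fun xy h => ⟨hmem _ h.1, hmem _ h.2.1⟩
  set F : Finset (ℤ × ℤ) := hS.toFinset
  let w : ℤ × ℤ → ℤ := fun xy => 2 * a * xy.1 + b * xy.2 + d
  have hw (xy : ℤ × ℤ) (h : xy ∈ F) : w xy ^ 2 = d ^ 2 - 4 * a * f - 2 * l * xy.2 := by
    have h' := (hS.mem_toFinset.mp h).2.2
    simp only [w]
    rw [hl]
    linear_combination 4 * a * h' - xy.2 ^ 2 * hΔ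
  have hinj : Set.InjOn w F := by
    intro p hp q hq hpq
    have h2 : p.2 = q.2 := by
      have h := hw p hp
      rw [hpq, hw q hq] at h
      exact (mul_left_cancel₀ (mul_ne_zero two_ne_zero hl0) (by linarith)).symm
    have h1 : p.1 = q.1 := by
      simp only [w, h2] at hpq
      exact mul_left_cancel₀ (mul_ne_zero two_ne_zero ha) (by linarith)
    exact Prod.ext h1 h2
  set T : Finset ℤ := F.image fun xy => |w xy|
  have hcard : F.card ≤ 2 * T.card := by
    refine Finset.card_le_mul_card_image (f := fun xy => |w xy|) F 2 fun t _ => ?_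
    calc (F.filter fun p => |w p| = t).card ≤ ({t, -t} : Finset ℤ).card := by
          refine Finset.card_le_card_of_injOn w ?_
            (hinj.mono (Finset.coe_subset.mpr (Finset.filter_subset _ _)))
          intro p hp
          have := (Finset.mem_filter.mp hp).2
          simpa using eq_or_eq_neg_of_abs_eq this
      _ ≤ 2 := Finset.card_le_two
  have hsq (p : ℤ × ℤ) (hp : p ∈ F) (q : ℤ × ℤ) (hq : q ∈ F) :
      |w p| ^ 2 - |w q| ^ 2 = l * (2 * (q.2 - p.2)) := by
    rw [sq_abs, sq_abs, hw p hp, hw q hq]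
    ring
  have hT := card_le_of_sq_modEq T m k hm hk (4 * m * P)
    (by simp only [T, Finset.forall_mem_image]; intros; positivity)
    (by
      simp only [T, Finset.forall_mem_image]
      intro p hp q hq
      rw [hsq p hp q hq, Int.natAbs_dvd]
      exact dvd_mul_right _ _)
    (by
      simp only [T, Finset.forall_mem_image]
      intro p hp q hq
      rw [hsq p hp q hq]
      have hp2 := (hS.mem_toFinset.mp hp).2.1
      have hq2 := (hS.mem_toFinset.mp hq).2.1
      have hlm : |(l : ℝ)| = m := by simp [m, Nat.cast_natAbs]
      push_cast
      calc (l : ℝ) * (2 * (q.2 - p.2)) ≤ |(l : ℝ) * (2 * (q.2 - p.2))| := le_abs_self _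
        _ = m * (2 * |(q.2 : ℝ) - p.2|) := by rw [abs_mul, abs_mul, hlm, abs_two]
        _ ≤ m * (2 * (P + P)) := by
          gcongr
          exact (abs_sub _ _).trans (add_le_add hq2 hp2)
        _ = 4 * m * P := by ring)
  have hsqrt : Real.sqrt (4 * m * P) / m = 2 * Real.sqrt (P / m) := by
    have : 4 * m * P = (2 * m) ^ 2 * (P / m) := by field_simp; ring
    rw [this, Real.sqrt_mul (by positivity), Real.sqrt_sq (by positivity)]
    field_simp
  rw [mul_div_assoc, hsqrt] at hT
  have hN : (Nat.card S : ℝ) = F.card := by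
    rw [Nat.card_coe_set_eq, Set.ncard_eq_toFinset_card S hS]
  have hcard' : (F.card : ℝ) ≤ 2 * T.card := by exact_mod_cast hcard
  have hD : (0 : ℝ) ≤ m.divisors.card := by positivity
  calc (Nat.card S : ℝ) ≤ 2 * (m.divisors.card * (1 + k * (2 * Real.sqrt (P / m)))) := by
        rw [hN]
        linarith
    _ ≤ 4 * m.divisors.card * (1 + k * Real.sqrt (P / m)) := by linarith


/-- **Quadratic lemma, case (vi).**
Suppose `Δ = 0` and either `a ≠ 0` and `l = 2ae - bd ≠ 0`, or `c ≠ 0` and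
`l = 2cd - be ≠ 0`, and let `k²` be the largest square dividing `|l|`.  Then the number
of integer solutions `(x,y)` of `ax² + bxy + cy² + dx + ey + f = 0` with `|x| ≤ P`,
`|y| ≤ P` is `≪_ε Q^ε (1 + k √(P/|l|))`. -/
theorem quadratic_count_case_vi (ε : ℝ) (hε : 0 < ε) :
    ∃ K : ℝ, ∀ (P Q : ℝ) (a b c d e f l : ℤ) (k : ℕ), 2 ≤ P → 2 ≤ Q →
      (|a| : ℝ) ≤ Q → (|b| : ℝ) ≤ Q → (|c| : ℝ) ≤ Q →
      (|d| : ℝ) ≤ Q → (|e| : ℝ) ≤ Q → (|f| : ℝ) ≤ Q →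
      4 * a * c - b ^ 2 = 0 →
      ((a ≠ 0 ∧ l = 2 * a * e - b * d) ∨ (c ≠ 0 ∧ l = 2 * c * d - b * e)) →
      l ≠ 0 →
      k ^ 2 ∣ l.natAbs → (∀ k' : ℕ, k' ^ 2 ∣ l.natAbs → k' ≤ k) →
      (Nat.card {xy : ℤ × ℤ // (|xy.1| : ℝ) ≤ P ∧ (|xy.2| : ℝ) ≤ P ∧
          a * xy.1 ^ 2 + b * xy.1 * xy.2 + c * xy.2 ^ 2 + d * xy.1 + e * xy.2 + f = 0} : ℝ)
        ≤ K * Q ^ ε * (1 + (k : ℝ) * Real.sqrt (P / (l.natAbs : ℝ))) := by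
  obtain ⟨C, hC, hdiv⟩ := exists_card_divisors_le_rpow (ε / 4) (by positivity)
  refine ⟨4 * C, ?_⟩
  intro P Q a b c d e f l k hP hQ ha hb hc hd he _ hΔ hcase hl0 _ hk
  have habs (r s t u : ℤ) (hr : (|r| : ℝ) ≤ Q) (hs : (|s| : ℝ) ≤ Q) (ht : (|t| : ℝ) ≤ Q)
      (hu : (|u| : ℝ) ≤ Q) (h : l = 2 * r * s - t * u) : (l.natAbs : ℝ) ≤ Q ^ (4 : ℝ) := by
    have h1 : (l.natAbs : ℝ) ≤ 2 * Q * Q + Q * Q := by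
      rw [Nat.cast_natAbs, h]
      push_cast
      refine (abs_sub _ _).trans ?_
      rw [abs_mul, abs_mul, abs_mul, abs_two]
      gcongr
    have h2 : Q ^ (4 : ℝ) = Q ^ 2 * Q ^ 2 := by
      rw [← pow_add]
      exact_mod_cast Real.rpow_natCast Q 4
    have h3 : 4 ≤ Q ^ 2 := by nlinarith
    rw [h2]
    nlinarith
  have key : (Nat.card {xy : ℤ × ℤ // (|xy.1| : ℝ) ≤ P ∧ (|xy.2| : ℝ) ≤ P ∧
        a * xy.1 ^ 2 + b * xy.1 * xy.2 + c * xy.2 ^ 2 + d * xy.1 + e * xy.2 + f = 0} : ℝ)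
      ≤ 4 * l.natAbs.divisors.card * (1 + (k : ℝ) * Real.sqrt (P / (l.natAbs : ℝ))) := by
    rcases hcase with ⟨ha0, hl⟩ | ⟨hc0, hl⟩
    · exact card_quadratic_zeros_le P a b c d e f l k hΔ ha0 hl hl0 hk
    · have hswap := card_quadratic_zeros_le P c b a e d f l k (by linarith) hc0 hl
        hl0 hk
      rwa [Nat.card_congr ((Equiv.prodComm ℤ ℤ).subtypeEquiv fun xy => ?_)]
      simp only [Equiv.prodComm_apply, Prod.fst_swap, Prod.snd_swap]
      rw [and_left_comm]
      refine and_congr_right fun _ => and_congr_right fun _ => ?_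
      ring_nf
  have hlQ : (l.natAbs : ℝ) ≤ Q ^ (4 : ℝ) := by
    rcases hcase with ⟨-, hl⟩ | ⟨-, hl⟩
    · exact habs a e b d ha he hb hd hl
    · exact habs c d b e hc hd hb he hl
  have hτ : (l.natAbs.divisors.card : ℝ) ≤ C * Q ^ ε := by
    refine (hdiv _ (Int.natAbs_ne_zero.mpr hl0)).trans ?_
    gcongr
    calc (l.natAbs : ℝ) ^ (ε / 4) ≤ (Q ^ (4 : ℝ)) ^ (ε / 4) := by gcongr
      _ = Q ^ ε := by
        rw [← Real.rpow_mul (by linarith)]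
        congr 1
        ring
  refine key.trans ?_
  rw [mul_assoc 4 C]
  gcongr
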